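/- For every natural number n ≥ 1 and every real number x with |x| < 1, the second moment of the n-th Meyer-König and Zeller operator satisfies (M_n e_2)(x) = 1 + (1/n!) · (1-x)^{n+1} · ( -2n · Li_1^{(n)}(x) + n^2 · Li_2^{(n)}(x) ), where Li_s^{(n)} denotes the n-th derivative of the polylogarithm Li_s. -/

import Mathlib

/-- The Meyer-König and Zeller operator. -/
noncomputable def MKZ (n : ℕ) (f : ℝ → ℝ) (x : ℝ) : ℝ :=
  (1 - x) ^ (n + 1) *
    ∑' ν : ℕ, (Nat.choose (ν + n) ν : ℝ) * f ((ν : ℝ) / ((ν : ℝ) + (n : ℝ))) * x ^ ν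

/-- The polylogarithm Li_s(x) = Σ_{ν≥1} x^ν / ν^s. -/
noncomputable def Li (s : ℕ) (x : ℝ) : ℝ :=
  ∑' ν : ℕ, x ^ (ν + 1) / ((ν : ℝ) + 1) ^ s

theorem summable_mul_pow_of_abs_le_descFactorial {a : ℕ → ℝ} {m : ℕ}
    (ha : ∀ k, |a k| ≤ (k + m).descFactorial m) {x : ℝ} (hx : |x| < 1) :
    Summable fun k => a k * x ^ k := by
  have hs := (summable_choose_mul_geometric_of_norm_lt_one (R := ℝ) m (r := |x|)
    (by simpa using hx)).mul_left (m.factorial : ℝ)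
  refine Summable.of_norm_bounded hs fun k => ?_
  rw [Real.norm_eq_abs, abs_mul, abs_pow, ← mul_assoc]
  refine mul_le_mul_of_nonneg_right ((ha k).trans_eq ?_) (by positivity)
  rw [Nat.descFactorial_eq_factorial_mul_choose, Nat.cast_mul]

theorem abs_succ_mul_le_descFactorial {a : ℕ → ℝ} {m : ℕ}
    (ha : ∀ k, |a k| ≤ (k + m).descFactorial m) (k : ℕ) :
    |((k : ℝ) + 1) * a (k + 1)| ≤ (k + (m + 1)).descFactorial (m + 1) := by
  have h : (k + (m + 1)).descFactorial (m + 1) = (k + 1) * (k + 1 + m).descFactorial m := by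
    rw [Nat.descFactorial_succ, show k + (m + 1) - m = k + 1 by omega,
      show k + (m + 1) = k + 1 + m by omega]
  rw [h, abs_mul, abs_of_nonneg (by positivity)]
  push_cast
  exact mul_le_mul_of_nonneg_left (ha (k + 1)) (by positivity)

theorem hasDerivAt_tsum_mul_pow {a : ℕ → ℝ} {m : ℕ}
    (ha : ∀ k, |a k| ≤ (k + m).descFactorial m) {x : ℝ} (hx : |x| < 1) :
    HasDerivAt (fun y => ∑' k, a k * y ^ k) (∑' k : ℕ, ((k : ℝ) + 1) * a (k + 1) * x ^ k) x := by
  obtain ⟨r, hxr, hr⟩ := exists_between hx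
  have hr0 : 0 < r := (abs_nonneg x).trans_lt hxr
  have hu : Summable fun k : ℕ => |a k| * (k * r ^ (k - 1)) := by
    rw [← summable_nat_add_iff 1]
    refine (summable_mul_pow_of_abs_le_descFactorial (abs_succ_mul_le_descFactorial ha)
      (x := r) (by rwa [abs_of_pos hr0])).abs.congr fun k => ?_
    rw [abs_mul, abs_mul, abs_of_pos (pow_pos hr0 k), abs_of_nonneg (by positivity)]
    push_cast [Nat.add_sub_cancel]
    ring
  have hball : ∀ y ∈ Metric.ball (0 : ℝ) r, |y| ≤ r := fun y hy => by
    simpa using (Metric.mem_ball.1 hy).le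
  have hd := hasDerivAt_tsum_of_isPreconnected (g := fun k y => a k * y ^ k)
    (g' := fun k y => a k * (k * y ^ (k - 1))) (y₀ := x) (y := x) hu Metric.isOpen_ball
    (convex_ball (0 : ℝ) r).isPreconnected (fun k y _ => (hasDerivAt_pow k y).const_mul (a k))
    (fun k y hy => by
      have := hball y hy
      rw [Real.norm_eq_abs, abs_mul, abs_mul, abs_pow, Nat.abs_cast]
      gcongr)
    (by simpa using hxr) (summable_mul_pow_of_abs_le_descFactorial ha hx) (by simpa using hxr)
  refine hd.congr_deriv ?_
  have hinj : Function.Injective Nat.succ := Nat.succ_injective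
  rw [← hinj.tsum_eq (f := fun k : ℕ => a k * (k * x ^ (k - 1)))]
  · refine tsum_congr fun k => ?_
    simp only [Nat.succ_eq_add_one, Nat.add_sub_cancel]
    push_cast
    ring
  · intro k hk
    rcases k with _ | k
    · simp at hk
    · exact ⟨k, rfl⟩

theorem iteratedDeriv_tsum_mul_pow (n : ℕ) {a : ℕ → ℝ} {m : ℕ}
    (ha : ∀ k, |a k| ≤ (k + m).descFactorial m) {x : ℝ} (hx : |x| < 1) :
    iteratedDeriv n (fun y => ∑' k, a k * y ^ k) x =
      ∑' k : ℕ, ((k + n).descFactorial n : ℝ) * a (k + n) * x ^ k := by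
  induction n generalizing a m with
  | zero => simp
  | succ n ih =>
    have hderiv : deriv (fun y => ∑' k, a k * y ^ k) =ᶠ[nhds x]
        fun y => ∑' k : ℕ, ((k : ℝ) + 1) * a (k + 1) * y ^ k := by
      filter_upwards [(isOpen_lt continuous_abs continuous_const).mem_nhds hx] with y hy
      exact (hasDerivAt_tsum_mul_pow ha hy).deriv
    rw [iteratedDeriv_succ', hderiv.iteratedDeriv_eq n, ih (abs_succ_mul_le_descFactorial ha)]
    refine tsum_congr fun k => ?_
    rw [← add_assoc k n 1, Nat.succ_descFactorial_succ]
    push_cast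
    ring

theorem Li_eq_tsum_inv_pow_mul {s : ℕ} (hs : s ≠ 0) :
    Li s = fun y => ∑' k : ℕ, ((k : ℝ) ^ s)⁻¹ * y ^ k := by
  funext y
  have hinj : Function.Injective Nat.succ := Nat.succ_injective
  rw [← hinj.tsum_eq (f := fun k : ℕ => ((k : ℝ) ^ s)⁻¹ * y ^ k), Li]
  · refine tsum_congr fun k => ?_
    rw [Nat.succ_eq_add_one]
    push_cast
    rw [div_eq_mul_inv, mul_comm]
  · intro k hk
    rcases k with _ | k
    · simp [hs] at hk
    · exact ⟨k, rfl⟩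

theorem abs_inv_natCast_pow_le_one (s k : ℕ) : |((k : ℝ) ^ s)⁻¹| ≤ 1 := by
  rw [abs_of_nonneg (by positivity), ← Nat.cast_pow]
  exact Nat.cast_inv_le_one _

theorem iteratedDeriv_Li {s : ℕ} (hs : s ≠ 0) (n : ℕ) {x : ℝ} (hx : |x| < 1) :
    iteratedDeriv n (Li s) x =
      n.factorial * ∑' k : ℕ, ((k + n).choose n : ℝ) * (((k : ℝ) + n) ^ s)⁻¹ * x ^ k := by
  rw [Li_eq_tsum_inv_pow_mul hs, iteratedDeriv_tsum_mul_pow n (m := 0)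
    (fun k => by simpa using abs_inv_natCast_pow_le_one s k) hx, ← tsum_mul_left]
  refine tsum_congr fun k => ?_
  rw [Nat.descFactorial_eq_factorial_mul_choose]
  push_cast
  ring

theorem summable_choose_mul_inv_pow_mul_pow (s n : ℕ) {x : ℝ} (hx : |x| < 1) :
    Summable fun k : ℕ => ((k + n).choose n : ℝ) * (((k : ℝ) + n) ^ s)⁻¹ * x ^ k := by
  refine summable_mul_pow_of_abs_le_descFactorial (m := n) (fun k => ?_) hx
  have h := abs_inv_natCast_pow_le_one s (k + n)
  push_cast at h
  rw [abs_mul, Nat.abs_cast]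
  refine (mul_le_of_le_one_right (by positivity) h).trans ?_
  rw [Nat.descFactorial_eq_factorial_mul_choose]
  exact_mod_cast Nat.le_mul_of_pos_left _ n.factorial_pos

theorem mkz_second_moment (n : ℕ) (hn : 1 ≤ n) (x : ℝ) (hx : |x| < 1) :
    MKZ n (fun t => t ^ 2) x =
      1 + (1 / (Nat.factorial n : ℝ)) * (1 - x) ^ (n + 1) *
        (-2 * (n : ℝ) * iteratedDeriv n (Li 1) x +
          (n : ℝ) ^ 2 * iteratedDeriv n (Li 2) x) := by
  have h0 := hasSum_choose_mul_geometric_of_norm_lt_one n (r := x) (by simpa using hx)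
  have h1 := (summable_choose_mul_inv_pow_mul_pow 1 n hx).hasSum.mul_left (-2 * (n : ℝ))
  have h2 := (summable_choose_mul_inv_pow_mul_pow 2 n hx).hasSum.mul_left ((n : ℝ) ^ 2)
  have hterm : ∀ k : ℕ, ((k + n).choose k : ℝ) * ((k : ℝ) / ((k : ℝ) + n)) ^ 2 * x ^ k =
      ((k + n).choose n : ℝ) * x ^ k +
        (-2 * (n : ℝ) * (((k + n).choose n : ℝ) * (((k : ℝ) + n) ^ 1)⁻¹ * x ^ k) +
        (n : ℝ) ^ 2 * (((k + n).choose n : ℝ) * (((k : ℝ) + n) ^ 2)⁻¹ * x ^ k)) := fun k => by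
    have hkn : (k : ℝ) + n ≠ 0 := by positivity
    rw [Nat.choose_symm_add]
    field_simp
    ring
  have hx1 : 1 - x ≠ 0 := (sub_pos.2 (abs_lt.1 hx).2).ne'
  rw [MKZ, tsum_congr hterm, (h0.add (h1.add h2)).tsum_eq, iteratedDeriv_Li one_ne_zero n hx,
    iteratedDeriv_Li two_ne_zero n hx]
  field_simp
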